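/- There is no uniquely C_7-saturated graph with at least 7 vertices. -/

import Mathlib

open SimpleGraph

/-- `G` has a cycle on `t` vertices (a cycle of length `t`). -/
def HasCycleOn {V : Type*} (G : SimpleGraph V) (t : ℕ) : Prop :=
  ∃ (v : V) (w : G.Walk v v), w.IsCycle ∧ w.length = t

/-- `c` is the edge set of some cycle on `t` vertices in `G`. -/
def IsCtEdgeSet {V : Type*} (G : SimpleGraph V) (t : ℕ) (c : Set (Sym2 V)) : Prop :=
  ∃ (v : V) (w : G.Walk v v), w.IsCycle ∧ w.length = t ∧ {e | e ∈ w.edges} = c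

/-- `G` is uniquely `C_t`-saturated: it has no cycle on `t` vertices, and adding any
edge of the complement creates exactly one cycle on `t` vertices. -/
def UniquelyCSat {V : Type*} (G : SimpleGraph V) (t : ℕ) : Prop :=
  ¬ HasCycleOn G t ∧
    ∀ x y : V, x ≠ y → ¬ G.Adj x y →
      ∃! c : Set (Sym2 V), IsCtEdgeSet (G ⊔ fromEdgeSet {s(x, y)}) t c

/-- The reformulation of unique `C₇`-saturation in terms of paths of length six. -/
structure HasUniqueSixPaths {V : Type*} (G : SimpleGraph V) : Prop where
  not_adj : ∀ {x y : V} (p : G.Walk x y), p.IsPath → p.length = 6 → ¬ G.Adj x y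
  unique : ∀ {x y : V} (p q : G.Walk x y), p.IsPath → q.IsPath → p.length = 6 → q.length = 6 → p = q
  exists_path : ∀ {x y : V}, x ≠ y → ¬ G.Adj x y → ∃ p : G.Walk x y, p.IsPath ∧ p.length = 6

section Walks

variable {V : Type*} {G : SimpleGraph V}

/-- A path is determined by its endpoints and its set of edges. -/
theorem SimpleGraph.Walk.IsPath.eq_of_edges {x y : V} {p q : G.Walk x y} (hp : p.IsPath)
    (hq : q.IsPath) (h : ∀ e, e ∈ p.edges ↔ e ∈ q.edges) : p = q := by
  induction p with
  | nil => exact (Walk.isPath_iff_nil.1 hq).eq_nil.symm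
  | @cons x v y hxv p ih =>
    cases q with
    | nil => simp at hp
    | @cons _ w _ hxw q =>
      rw [Walk.cons_isPath_iff] at hp hq
      have hx : ∀ {u z : V} {r : G.Walk u z}, x ∉ r.support → ∀ t, s(x, t) ∉ r.edges :=
        fun hr t ht => hr (Walk.fst_mem_support_of_mem_edges _ ht)
      have hvw : v = w := by
        have := (h s(x, v)).1 (by simp)
        rw [Walk.edges_cons, List.mem_cons] at this
        rcases this with this | this
        · exact Sym2.congr_right.1 this
        · exact absurd this (hx hq.2 v)
      subst hvw
      congr 1
      refine ih hp.1 hq.1 fun e => ?_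
      have he := h e
      simp only [Walk.edges_cons, List.mem_cons] at he
      constructor
      · intro hep
        rcases he.1 (Or.inr hep) with rfl | h'
        · exact absurd hep (hx hp.2 v)
        · exact h'
      · intro heq
        rcases he.2 (Or.inr heq) with rfl | h'
        · exact absurd heq (hx hq.2 v)
        · exact h'

/-- A cycle through the edge `xy` is that edge followed by a path from `y` to `x`. -/
theorem SimpleGraph.Walk.IsCycle.exists_cons {u x y : V} {c : G.Walk u u} (hc : c.IsCycle)
    (he : s(x, y) ∈ c.edges) : ∃ (_ : G.Adj x y) (p : G.Walk y x),
      p.IsPath ∧ s(x, y) ∉ p.edges ∧ p.length + 1 = c.length := by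
  classical
  wlog hd : ∃ h : G.Adj x y, ⟨(x, y), h⟩ ∈ c.darts generalizing c
  · rw [← c.length_reverse]
    refine this hc.reverse (by simpa using he) ?_
    obtain ⟨⟨⟨a, b⟩, hab⟩, hmem, hd'⟩ := List.mem_map.1 he
    simp only [Dart.edge_mk, Sym2.eq_iff] at hd'
    rcases hd' with ⟨rfl, rfl⟩ | ⟨rfl, rfl⟩
    · exact absurd ⟨hab, hmem⟩ hd
    · exact ⟨hab.symm, by
        rw [Walk.darts_reverse, List.mem_reverse]
        exact List.mem_map.2 ⟨_, hmem, rfl⟩⟩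
  obtain ⟨h, hd⟩ := hd
  have hx : x ∈ c.support := Walk.dart_fst_mem_support_of_mem_darts _ hd
  have hd' : (⟨(x, y), h⟩ : G.Dart) ∈ (c.rotate x hx).darts :=
    (c.rotate_darts x hx).perm.mem_iff.2 hd
  have hl : (c.rotate x hx).length = c.length := by simp
  have hc' : (c.rotate x hx).IsCycle := hc.rotate hx
  generalize c.rotate x hx = r at *
  cases r with
  | nil => simp at hd'
  | @cons _ v _ hxv p =>
    rw [Walk.cons_isCycle_iff] at hc'
    rw [Walk.darts_cons, List.mem_cons] at hd'
    rcases hd' with hd' | hd'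
    · obtain rfl : y = v := by simpa [Dart.ext_iff] using hd'
      exact ⟨h, p, hc'.1, hc'.2, by simpa using hl⟩
    · exfalso
      have h1 : x ∈ p.support.dropLast := by
        rw [← Walk.map_fst_darts]
        exact List.mem_map.2 ⟨_, hd', rfl⟩
      have h2 := hc'.1.support_nodup
      rw [← List.dropLast_append_getLast p.support_ne_nil, List.nodup_append] at h2
      exact h2.2.2 x h1 x (by simp) rfl

theorem UniquelyCSat.hasUniqueSixPaths (h : UniquelyCSat G 7) : HasUniqueSixPaths G := by
  have not_adj : ∀ {x y : V} (p : G.Walk x y), p.IsPath → p.length = 6 → ¬ G.Adj x y := by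
    intro x y p hp hl hxy
    refine h.1 ⟨y, p.cons hxy.symm, ?_, by simp [hl]⟩
    rw [Walk.cons_isCycle_iff]
    refine ⟨hp, fun he => ?_⟩
    cases p with
    | nil => simp at hl
    | @cons _ v _ hxv p =>
      rw [Walk.cons_isPath_iff] at hp
      rw [Walk.edges_cons, List.mem_cons] at he
      rcases he with he | he
      · obtain rfl : y = v := Sym2.congr_right.1 (Sym2.eq_swap.trans he)
        simp [(Walk.isPath_iff_nil.1 hp.1).eq_nil] at hl
      · exact hp.2 (Walk.snd_mem_support_of_mem_edges _ he)
  have closed : ∀ {x y : V} (p : G.Walk x y), p.IsPath → p.length = 6 →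
      IsCtEdgeSet (G ⊔ fromEdgeSet {s(x, y)}) 7 (insert s(x, y) {e | e ∈ p.edges}) := by
    intro x y p hp hl
    have hxy := not_adj p hp hl
    have hne : x ≠ y := by
      rintro rfl
      simp [(Walk.isPath_iff_nil.1 hp).eq_nil] at hl
    have hadj : (G ⊔ fromEdgeSet {s(x, y)}).Adj y x := by simp [hne.symm, Sym2.eq_swap]
    refine ⟨y, (p.mapLe le_sup_left).cons hadj, ?_, by simp [hl], ?_⟩
    · rw [Walk.cons_isCycle_iff]
      refine ⟨by simpa using hp, fun he => hxy ?_⟩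
      rw [Walk.edges_mapLe_eq_edges] at he
      exact (p.adj_of_mem_edges he).symm
    · ext e
      simp [Sym2.eq_swap]
  refine ⟨not_adj, fun {x y} p q hp hq hpl hql => ?_, fun {x y} hne hxy => ?_⟩
  · have hxy := not_adj p hp hpl
    have hne : x ≠ y := by
      rintro rfl
      simp [(Walk.isPath_iff_nil.1 hp).eq_nil] at hpl
    have heq := (h.2 x y hne hxy).unique (closed p hp hpl) (closed q hq hql)
    have hnot : ∀ (r : G.Walk x y), s(x, y) ∉ r.edges := fun r hr => hxy (r.adj_of_mem_edges hr)
    refine hp.eq_of_edges hq fun e => ?_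
    have := Set.ext_iff.1 heq e
    simp only [Set.mem_insert_iff, Set.mem_ofPred_eq] at this
    by_cases he : e = s(x, y)
    · subst he
      simp [hnot]
    · simpa [he] using this
  · obtain ⟨_, ⟨u, c, hc, hl, -⟩, -⟩ := h.2 x y hne hxy
    have hG : ∀ e, e ∈ (G ⊔ fromEdgeSet {s(x, y)}).edgeSet → e ≠ s(x, y) → e ∈ G.edgeSet := by
      intro e he hne'
      induction e with
      | _ a b => simpa [hne'] using he
    have hmem : s(y, x) ∈ c.edges := by
      by_contra hmem
      have hall : ∀ e ∈ c.edges, e ∈ G.edgeSet := fun e he =>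
        hG e (c.edges_subset_edgeSet he) fun h' => hmem (Sym2.eq_swap.trans h'.symm ▸ he)
      exact h.1 ⟨u, c.transfer G hall, hc.transfer hall, by simpa using hl⟩
    obtain ⟨_, p, hp, hep, hpl⟩ := hc.exists_cons hmem
    have hall : ∀ e ∈ p.edges, e ∈ G.edgeSet := fun e he =>
      hG e (p.edges_subset_edgeSet he) fun h' => hep (Sym2.eq_swap.trans h'.symm ▸ he)
    exact ⟨p.transfer G hall, hp.transfer hall, by simp; omega⟩

/-- In a graph without induced paths on three vertices, reachable vertices are adjacent. -/
theorem SimpleGraph.Walk.eq_or_adj (h : ∀ x z y, G.Adj x z → G.Adj z y → x ≠ y → G.Adj x y)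
    {x y : V} (p : G.Walk x y) : x = y ∨ G.Adj x y := by
  induction p with
  | nil => exact Or.inl rfl
  | @cons x z y hxz p ih =>
    rcases ih with rfl | ih
    · exact Or.inr hxz
    · exact or_iff_not_imp_left.2 (h x z y hxz ih)

/-- A graph on at least seven vertices with unique paths of length six contains an induced
path on three vertices. -/
theorem HasUniqueSixPaths.exists_induced_path [Fintype V] (hG : HasUniqueSixPaths G)
    (hn : 7 ≤ Fintype.card V) : ∃ x z y, G.Adj x z ∧ G.Adj z y ∧ x ≠ y ∧ ¬ G.Adj x y := by
  by_contra! hP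
  have hall : ∀ x y, x ≠ y → G.Adj x y := by
    intro x y hne
    by_contra hxy
    obtain ⟨p, -⟩ := hG.exists_path hne hxy
    exact (p.eq_or_adj hP).elim hne hxy
  obtain ⟨e⟩ : Nonempty (Fin 7 ↪ V) := Function.Embedding.nonempty_of_card_le (by simpa using hn)
  have hadj : ∀ i j : Fin 7, i ≠ j → G.Adj (e i) (e j) := fun i j hij =>
    hall _ _ (e.injective.ne hij)
  refine hG.not_adj (.cons (hadj 0 1 (by decide)) <| .cons (hadj 1 2 (by decide)) <|
    .cons (hadj 2 3 (by decide)) <| .cons (hadj 3 4 (by decide)) <|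
    .cons (hadj 4 5 (by decide)) <| .cons (hadj 5 6 (by decide)) .nil) ?_ rfl
    (hadj 0 6 (by decide))
  simp [Walk.isPath_def]

end Walks

/-! ### A refutation procedure for partial descriptions of a graph

A finite partial description of a graph is a list of adjacency lists. The definitions below use
recursors directly, which makes them much faster to evaluate in the kernel. -/

namespace SixPaths

/-- Membership in a list of natural numbers. -/
def mem (w : ℕ) (l : List ℕ) : Bool :=
  List.rec (motive := fun _ => Bool) false (fun b _ ih => Bool.rec ih true (Nat.beq w b)) l

/-- Does some number below `n` satisfy `f`? -/
def anyBelow (f : ℕ → Bool) (n : ℕ) : Bool :=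
  Nat.rec (motive := fun _ => Bool) false (fun b ih => Bool.rec ih true (f b)) n

/-- The neighbours of `a` in the partial description `A`. -/
def nbrs (A : List (List ℕ)) (a : ℕ) : List ℕ :=
  List.rec (motive := fun _ => ℕ → List ℕ) (fun _ => [])
    (fun r _ ih a => Nat.rec r (fun b _ => ih b) a) A a

/-- Add `b` to the neighbours of `a`. -/
def addNbr (b : ℕ) (A : List (List ℕ)) (a : ℕ) : List (List ℕ) :=
  List.rec (motive := fun _ => ℕ → List (List ℕ)) (fun _ => [])
    (fun r A ih a => Nat.rec ((b :: r) :: A) (fun c _ => r :: ih c) a) A a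

/-- Add the edge `ab`. -/
def addEdge (A : List (List ℕ)) (a b : ℕ) : List (List ℕ) := addNbr a (addNbr b A a) b

/-- Prepend to `out` all extensions by `L` further vertices of the path `a :: acc`, whose current
end is its head. -/
def pathsFrom (A : List (List ℕ)) (L : ℕ) : ℕ → List ℕ → List (List ℕ) → List (List ℕ) :=
  Nat.rec (fun a acc out => (a :: acc) :: out)
    (fun _ ih a acc out => List.rec (motive := fun _ => List (List ℕ)) out
      (fun w _ r => Bool.rec (ih w (a :: acc) r) r (mem w acc)) (nbrs A a)) L

/-- Two distinct lists with the same head. -/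
def clash (p q : List ℕ) : Bool := Bool.rec false (p != q) (Nat.beq (p.headD 0) (q.headD 0))

/-- Some list in `P` clashes with `p`. -/
def clashAny (p : List ℕ) (P : List (List ℕ)) : Bool :=
  List.rec (motive := fun _ => Bool) false (fun q _ ih => Bool.rec ih true (clash p q)) P

/-- Two lists in `P` clash, or the head of a list in `P` belongs to `na`. -/
def bad (na : List ℕ) (P : List (List ℕ)) : Bool :=
  List.rec (motive := fun _ => Bool) false
    (fun p P ih => Bool.rec (Bool.rec ih true (clashAny p P)) true (mem (p.headD 0) na)) P

/-- The partial description contains a cycle of length seven or two distinct paths of length six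
with the same ends. -/
def conflict (A : List (List ℕ)) : Bool :=
  anyBelow (fun a => bad (nbrs A a) (pathsFrom A 6 a [] [])) A.length

/-- The descriptions refining `A` in which `ab` is an edge: at most one. -/
def withEdge (A : List (List ℕ)) (a b : ℕ) : List (List (List ℕ)) :=
  bif mem b (nbrs A a) then [A]
  else bif conflict (addEdge A a b) then [] else [addEdge A a b]

/-- The descriptions refining `A` in which there is a path of length `L + 1` from `x` to `y`
avoiding `used`; vertices of the path may be new. -/
def extensions (y : ℕ) : ℕ → List (List ℕ) → ℕ → List ℕ → List (List (List ℕ))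
  | 0, A, x, _ => withEdge A x y
  | L + 1, A, x, used =>
    ((List.range A.length).flatMap fun w =>
      bif mem w (y :: x :: used) then []
      else (withEdge A x w).flatMap fun B => extensions y L B w (x :: used)) ++
    extensions y L (addEdge (A ++ [[]]) x A.length) A.length (x :: used)

/-- A plan for refuting a list of descriptions one after the other: for each of them, a pair of
vertices that cannot be adjacent, and a plan for the possible paths of length six joining them. -/
inductive Plan
  | nil
  | node (x y : ℕ) (paths next : Plan)

/-- The plan refutes all the descriptions in the list. -/
def refutes : Plan → List (List (List ℕ)) → Bool
  | _, [] => true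
  | .nil, _ :: _ => false
  | .node x y paths next, A :: As =>
    decide (x < A.length) && decide (y < A.length) && !Nat.beq x y && conflict (addEdge A x y) &&
      refutes paths (extensions y 5 A x []) && refutes next As

theorem mem_iff {w : ℕ} {l : List ℕ} : mem w l = true ↔ w ∈ l := by
  induction l with
  | nil => simp [mem]
  | cons b l ih =>
    have h : mem w (b :: l) = Bool.rec (mem w l) true (Nat.beq w b) := rfl
    rw [h, List.mem_cons, ← ih]
    cases hb : Nat.beq w b with
    | true => simp [Nat.eq_of_beq_eq_true hb]
    | false => simp [Nat.ne_of_beq_eq_false hb]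

theorem exists_of_anyBelow {f : ℕ → Bool} {n : ℕ} (h : anyBelow f n = true) :
    ∃ i < n, f i = true := by
  induction n with
  | zero => simp [anyBelow] at h
  | succ n ih =>
    have h' : anyBelow f (n + 1) = Bool.rec (anyBelow f n) true (f n) := rfl
    rw [h'] at h
    cases hf : f n with
    | true => exact ⟨n, n.lt_succ_self, hf⟩
    | false =>
      rw [hf] at h
      obtain ⟨i, hi, hfi⟩ := ih h
      exact ⟨i, by omega, hfi⟩

theorem nbrs_eq (A : List (List ℕ)) (a : ℕ) : nbrs A a = A.getD a [] := by
  induction A generalizing a with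
  | nil => simp [nbrs]
  | cons r A ih =>
    cases a with
    | zero => simp [nbrs]
    | succ a =>
      rw [List.getD_cons_succ]
      exact ih a

theorem addNbr_eq (b : ℕ) (A : List (List ℕ)) (a : ℕ) : addNbr b A a = A.modify a (b :: ·) := by
  induction A generalizing a with
  | nil => simp [addNbr]
  | cons r A ih =>
    cases a with
    | zero => simp [addNbr]
    | succ a =>
      rw [List.modify_succ_cons]
      exact congrArg (r :: ·) (ih a)

theorem length_addEdge (A : List (List ℕ)) (a b : ℕ) : (addEdge A a b).length = A.length := by
  simp [addEdge, addNbr_eq]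

theorem mem_nbrs_addNbr {A : List (List ℕ)} {a b i c : ℕ} (h : c ∈ nbrs (addNbr b A a) i) :
    c ∈ nbrs A i ∨ i = a ∧ c = b := by
  rw [nbrs_eq, addNbr_eq, List.getD_eq_getElem?_getD, List.getElem?_modify] at h
  rw [nbrs_eq, List.getD_eq_getElem?_getD]
  cases hA : A[i]? with
  | none => simp [hA] at h
  | some r =>
    by_cases hia : a = i
    · simp [hA, hia] at h
      grind
    · exact Or.inl (by simpa [hA, hia] using h)

theorem mem_nbrs_addEdge {A : List (List ℕ)} {a b i c : ℕ} (h : c ∈ nbrs (addEdge A a b) i) :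
    c ∈ nbrs A i ∨ i = a ∧ c = b ∨ i = b ∧ c = a := by
  rcases mem_nbrs_addNbr h with h | h
  · rcases mem_nbrs_addNbr h with h | h <;> simp [h]
  · simp [h]

theorem exists_of_clashAny {p : List ℕ} {P : List (List ℕ)} (h : clashAny p P = true) :
    ∃ q ∈ P, p.headD 0 = q.headD 0 ∧ p ≠ q := by
  induction P with
  | nil => simp [clashAny] at h
  | cons q P ih =>
    have h' : clashAny p (q :: P) = Bool.rec (clashAny p P) true (clash p q) := rfl
    rw [h'] at h
    cases hc : clash p q with
    | false =>
      rw [hc] at h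
      obtain ⟨q', hq', hpq⟩ := ih h
      exact ⟨q', by simp [hq'], hpq⟩
    | true =>
      refine ⟨q, by simp, ?_⟩
      rw [clash] at hc
      cases hb : Nat.beq (p.headD 0) (q.headD 0) with
      | false =>
        rw [hb] at hc
        simp at hc
      | true =>
        rw [hb] at hc
        exact ⟨Nat.eq_of_beq_eq_true hb, by simpa using hc⟩

theorem exists_of_bad {na : List ℕ} {P : List (List ℕ)} (h : bad na P = true) :
    ∃ p ∈ P, p.headD 0 ∈ na ∨ ∃ q ∈ P, p.headD 0 = q.headD 0 ∧ p ≠ q := by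
  induction P with
  | nil => simp [bad] at h
  | cons p P ih =>
    have h' : bad na (p :: P) =
      Bool.rec (Bool.rec (bad na P) true (clashAny p P)) true (mem (p.headD 0) na) := rfl
    rw [h'] at h
    cases hm : mem (p.headD 0) na with
    | true => exact ⟨p, by simp, Or.inl (mem_iff.1 hm)⟩
    | false =>
      cases hc : clashAny p P with
      | true =>
        obtain ⟨q, hq, hpq⟩ := exists_of_clashAny hc
        exact ⟨p, by simp, Or.inr ⟨q, by simp [hq], hpq⟩⟩
      | false =>
        rw [hm, hc] at h
        obtain ⟨p, hp, hpq⟩ := ih h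
        refine ⟨p, by simp [hp], hpq.imp_right ?_⟩
        rintro ⟨q, hq, hpq⟩
        exact ⟨q, by simp [hq], hpq⟩

variable {V : Type*} {G : SimpleGraph V} {A : List (List ℕ)} {f : ℕ → V}

/-- The partial description `A` is realized in `G` by the vertices `f i` for `i < A.length`. -/
structure Realizes (G : SimpleGraph V) (A : List (List ℕ)) (f : ℕ → V) : Prop where
  injOn : Set.InjOn f {i | i < A.length}
  lt : ∀ {a b : ℕ}, b ∈ nbrs A a → b < A.length
  adj : ∀ {a b : ℕ}, b ∈ nbrs A a → G.Adj (f a) (f b)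

theorem Realizes.addEdge (h : Realizes G A f) {a b : ℕ} (ha : a < A.length) (hb : b < A.length)
    (hab : G.Adj (f a) (f b)) : Realizes G (addEdge A a b) f := by
  refine ⟨by simpa [length_addEdge] using h.injOn, fun hc => ?_, fun hc => ?_⟩
  · rw [length_addEdge]
    rcases mem_nbrs_addEdge hc with hc | ⟨-, rfl⟩ | ⟨-, rfl⟩
    exacts [h.lt hc, hb, ha]
  · rcases mem_nbrs_addEdge hc with hc | ⟨rfl, rfl⟩ | ⟨rfl, rfl⟩
    exacts [h.adj hc, hab, hab.symm]

theorem Realizes.update (h : Realizes G A f) {v : V} (hv : ∀ i < A.length, f i ≠ v) :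
    Realizes G (A ++ [[]]) (Function.update f A.length v) := by
  have hnbrs : ∀ a, nbrs (A ++ [[]]) a = nbrs A a := by
    intro a
    simp only [nbrs_eq, List.getD_eq_getElem?_getD, List.getElem?_append]
    split_ifs with ha
    · rfl
    · rw [List.getElem?_eq_none (l := A) (by omega)]
      rcases a - A.length with _ | k <;> simp
  have hlt : ∀ {a b}, b ∈ nbrs A a → a < A.length := by
    intro a b hb
    by_contra ha
    rw [nbrs_eq, List.getD_eq_getElem?_getD, List.getElem?_eq_none (by omega)] at hb
    simp at hb
  refine ⟨fun i hi j hj hij => ?_, fun {a b} hb => ?_, fun {a b} hb => ?_⟩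
  · simp only [List.length_append, List.length_singleton, Set.mem_ofPred_eq] at hi hj
    have hinj := @h.injOn i
    simp only [Function.update_apply, Set.mem_ofPred_eq] at hij hinj
    split_ifs at hij with h1 h2 h2
    · omega
    · exact absurd hij.symm (hv j (by omega))
    · exact absurd hij (hv i (by omega))
    · exact hinj (by omega) (show j < A.length by omega) hij
  · rw [hnbrs] at hb
    have := h.lt hb
    simp
    omega
  · rw [hnbrs] at hb
    rw [Function.update_of_ne (hlt hb).ne, Function.update_of_ne (h.lt hb).ne]
    exact h.adj hb

theorem Realizes.exists_walk (h : Realizes G A f) {L a s : ℕ} {acc l : List ℕ}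
    {out : List (List ℕ)} (hl : l ∈ pathsFrom A L a acc out)
    (hlt : ∀ i ∈ a :: acc, i < A.length) (p : G.Walk (f a) (f s)) (hp : p.IsPath)
    (hsupp : p.support = (a :: acc).map f) :
    l ∈ out ∨ ∃ (w : ℕ) (q : G.Walk (f w) (f s)), l.headD 0 = w ∧ q.IsPath ∧
      q.support = l.map f ∧ q.length = L + p.length ∧ ∀ i ∈ l, i < A.length := by
  induction L generalizing a acc out with
  | zero =>
    rcases List.mem_cons.1 (show l ∈ (a :: acc) :: out from hl) with rfl | hl
    · exact Or.inr ⟨a, p, rfl, hp, hsupp, by simp, hlt⟩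
    · exact Or.inl hl
  | succ L ih =>
    have key : ∀ N : List ℕ, (∀ w ∈ N, w ∈ nbrs A a) →
        l ∈ List.rec (motive := fun _ => List (List ℕ)) out
          (fun w _ r => Bool.rec (pathsFrom A L w (a :: acc) r) r (mem w acc)) N →
        l ∈ out ∨ ∃ (w : ℕ) (q : G.Walk (f w) (f s)), l.headD 0 = w ∧ q.IsPath ∧
          q.support = l.map f ∧ q.length = L + 1 + p.length ∧ ∀ i ∈ l, i < A.length := by
      intro N hN hlN
      induction N with
      | nil => exact Or.inl hlN
      | cons w N ihN =>
        have hN' : ∀ w ∈ N, w ∈ nbrs A a := fun w hw => hN w (by simp [hw])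
        cases hm : mem w acc with
        | true =>
          simp only [hm] at hlN
          exact ihN hN' hlN
        | false =>
          simp only [hm] at hlN
          have hw : w ∈ nbrs A a := hN w (by simp)
          have hwacc : w ∉ acc := fun hmem => by simp [mem_iff.2 hmem] at hm
          have hwp : f w ∉ p.support := by
            rw [hsupp, List.mem_map]
            rintro ⟨i, hi, hiw⟩
            obtain rfl : i = w := h.injOn (hlt i hi) (h.lt hw) hiw
            rcases List.mem_cons.1 hi with rfl | hi
            · exact G.irrefl (h.adj hw)
            · exact hwacc hi
          rcases ih hlN (by simpa [h.lt hw] using hlt) (p.cons (h.adj hw).symm)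
            (hp.cons hwp) (by simp [hsupp]) with hl' | ⟨w', q, h1, h2, h3, h4, h5⟩
          · exact ihN hN' hl'
          · exact Or.inr ⟨w', q, h1, h2, h3, by simp at h4; omega, h5⟩
    exact key _ (fun _ h => h) hl

theorem _root_.Set.InjOn.eq_of_map_eq {α β : Type*} {f : α → β} {s : Set α} (hf : s.InjOn f)
    {l₁ l₂ : List α} (h₁ : ∀ a ∈ l₁, a ∈ s) (h₂ : ∀ a ∈ l₂, a ∈ s) (h : l₁.map f = l₂.map f) :
    l₁ = l₂ := by
  induction l₁ generalizing l₂ with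
  | nil => simpa using h.symm
  | cons a l₁ ih =>
    cases l₂ with
    | nil => simp at h
    | cons b l₂ =>
      simp only [List.map_cons, List.cons.injEq, List.forall_mem_cons] at h h₁ h₂
      rw [hf h₁.1 h₂.1 h.1, ih h₁.2 h₂.2 h.2]

theorem Realizes.conflict_eq_false (hG : HasUniqueSixPaths G) (h : Realizes G A f) :
    conflict A = false := by
  by_contra hc
  obtain ⟨a, ha, hbad⟩ := exists_of_anyBelow (eq_true_of_ne_false hc)
  have walk : ∀ l ∈ pathsFrom A 6 a [] [], ∃ (w : ℕ) (q : G.Walk (f w) (f a)),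
      l.headD 0 = w ∧ q.IsPath ∧ q.support = l.map f ∧ q.length = 6 ∧ ∀ i ∈ l, i < A.length := by
    intro l hl
    simpa using h.exists_walk hl (by simpa using ha) .nil .nil (by simp)
  obtain ⟨p, hp, hbad⟩ := exists_of_bad hbad
  obtain ⟨w, p', hpw, hp1, hp2, hp3, hp4⟩ := walk p hp
  rcases hbad with hadj | ⟨q, hq, hpq, hne⟩
  · exact hG.not_adj p' hp1 hp3 (h.adj (hpw ▸ hadj)).symm
  · obtain ⟨w', q', hqw, hq1, hq2, hq3, hq4⟩ := walk q hq
    obtain rfl : w = w' := by rw [← hpw, ← hqw, hpq]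
    have hmap : p.map f = q.map f := by rw [← hp2, ← hq2, hG.unique p' q' hp1 hq1 hp3 hq3]
    exact hne (h.injOn.eq_of_map_eq hp4 hq4 hmap)

theorem Realizes.exists_withEdge (hG : HasUniqueSixPaths G) (h : Realizes G A f) {a b : ℕ}
    (ha : a < A.length) (hb : b < A.length) (hab : G.Adj (f a) (f b)) :
    ∃ B ∈ withEdge A a b, Realizes G B f ∧ B.length = A.length := by
  have h' := h.addEdge ha hb hab
  rw [withEdge, h'.conflict_eq_false hG]
  cases mem b (nbrs A a)
  · exact ⟨_, by simp, h', length_addEdge ..⟩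
  · exact ⟨A, by simp, h, rfl⟩

theorem Realizes.exists_extension (hG : HasUniqueSixPaths G) {L x y : ℕ} {used : List ℕ}
    (h : Realizes G A f) (hx : x < A.length) (hy : y < A.length)
    (hused : ∀ i ∈ used, i < A.length) {u v : V} (hu : f x = u) (hv : f y = v) (p : G.Walk u v)
    (hp : p.IsPath) (hl : p.length = L + 1) (hpu : ∀ i ∈ used, f i ∉ p.support) :
    ∃ B ∈ extensions y L A x used, ∃ g, Realizes G B g := by
  induction L generalizing A f x used u with
  | zero =>
    obtain ⟨B, hB, hBf, -⟩ :=
      h.exists_withEdge hG hx hy (hu ▸ hv ▸ Walk.adj_of_length_eq_one (by simpa using hl))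
    exact ⟨B, hB, f, hBf⟩
  | succ L ih =>
    cases p with
    | nil => simp at hl
    | @cons _ t _ hut p =>
      subst hu hv
      rw [Walk.cons_isPath_iff] at hp
      have hl' : p.length = L + 1 := by simpa using hl
      have hty : t ≠ f y := by
        rintro rfl
        simp [(Walk.isPath_iff_nil.1 hp.1).eq_nil] at hl'
      have hused' : ∀ i ∈ x :: used, f i ∉ p.support := by
        intro i hi hip
        rcases List.mem_cons.1 hi with rfl | hi
        · exact hp.2 hip
        · exact hpu i hi (by simp [hip])
      have hlt : ∀ i ∈ x :: used, i < A.length := by simpa [hx] using hused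
      rw [extensions]
      by_cases ht : ∃ w < A.length, f w = t
      · obtain ⟨w, hw, rfl⟩ := ht
        obtain ⟨B, hB, hBf, hBA⟩ := h.exists_withEdge hG hx hw hut
        obtain ⟨C, hC, g, hg⟩ := ih hBf (hBA ▸ hw) (hBA ▸ hy) (hBA ▸ hlt) rfl rfl p hp.1 hl' hused'
        refine ⟨C, List.mem_append_left _ (List.mem_flatMap.2 ⟨w, by simpa using hw, ?_⟩), g, hg⟩
        have hm : mem w (y :: x :: used) = false := by
          rw [← Bool.not_eq_true, mem_iff, List.mem_cons, not_or]
          exact ⟨fun h' => hty (congrArg f h'), fun h' => hused' w h' p.start_mem_support⟩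
        rw [hm]
        exact List.mem_flatMap.2 ⟨B, hB, hC⟩
      · push Not at ht
        have hf : ∀ i < A.length, Function.update f A.length t i = f i := fun i hi =>
          Function.update_of_ne hi.ne _ _
        have hB := (h.update ht).addEdge (a := x) (b := A.length) (by simp; omega) (by simp)
          (by simpa [hf x hx] using hut)
        obtain ⟨C, hC, g, hg⟩ := ih hB (x := A.length) (used := x :: used)
          (by simp [length_addEdge]) (by simp [length_addEdge]; omega)
          (fun i hi => by have := hlt i hi; simp [length_addEdge]; omega)
          (by simp) (hf y hy) p hp.1 hl' (fun i hi => by rw [hf i (hlt i hi)]; exact hused' i hi)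
        exact ⟨C, List.mem_append_right _ hC, g, hg⟩

theorem not_realizes_of_refutes (hG : HasUniqueSixPaths G) {P : Plan}
    {As : List (List (List ℕ))} (hP : refutes P As = true) :
    ∀ A ∈ As, ∀ f, ¬ Realizes G A f := by
  induction P generalizing As with
  | nil => cases As <;> simp [refutes] at hP ⊢
  | node x y paths next ih₁ ih₂ =>
    cases As with
    | nil => simp
    | cons A As =>
      simp only [refutes, Bool.and_eq_true, decide_eq_true_eq, Bool.not_eq_true'] at hP
      obtain ⟨⟨⟨⟨⟨hx, hy⟩, hxy⟩, hc⟩, h₁⟩, h₂⟩ := hP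
      refine List.forall_mem_cons.2 ⟨fun f hf => ?_, ih₂ h₂⟩
      have hne : f x ≠ f y := fun h' => Nat.ne_of_beq_eq_false hxy (hf.injOn hx hy h')
      have hadj : ¬ G.Adj (f x) (f y) := fun h' => by
        simp [(hf.addEdge hx hy h').conflict_eq_false hG] at hc
      obtain ⟨p, hp, hl⟩ := hG.exists_path hne hadj
      obtain ⟨B, hB, g, hg⟩ := hf.exists_extension hG hx hy (used := []) (L := 5) (by simp) rfl rfl
        p hp hl (by simp)
      exact ih₁ h₁ B hB g hg

open Plan in
/-- A plan for refuting the possible paths of length six joining the ends `0` and `2` of an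
induced path. -/
def plan : Plan :=
  node 0 4 (node 0 5 nil <| node 0 5 nil <| node 2 5 nil <| node 2 5 nil nil) <|
  node 0 5 (node 3 6 nil <| node 2 5 nil nil) <|
  node 0 6 nil <|
  node 2 4 (node 2 3 nil <| node 3 5 nil nil) <|
  node 2 5 (node 2 4 nil <| node 4 6 nil <| node 0 4 nil <| node 0 4 nil nil) <|
  node 4 7 (node 6 8 nil <| node 2 5 nil <| node 7 8 nil <| node 2 8 nil <| node 4 8 nil <|
    node 3 6 nil <| node 5 8 nil nil) nil

theorem refutes_plan : refutes plan (extensions 2 5 [[1], [0, 2], [1]] 0 []) = true := by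
  decide +kernel

theorem _root_.HasUniqueSixPaths.adj (hG : HasUniqueSixPaths G) {x z y : V} (hxz : G.Adj x z)
    (hzy : G.Adj z y) (hxy : x ≠ y) : G.Adj x y := by
  by_contra hadj
  obtain ⟨p, hp, hl⟩ := hG.exists_path hxy hadj
  let f : ℕ → V := fun i => if i = 0 then x else if i = 1 then z else y
  have hf : Realizes G [[1], [0, 2], [1]] f := by
    refine ⟨fun i hi j hj hij => ?_, fun {a b} hb => ?_, fun {a b} hb => ?_⟩
    · simp only [List.length_cons, List.length_nil, Set.mem_ofPred_eq] at hi hj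
      have h₁ := hxz.ne
      have h₂ := hzy.ne
      interval_cases i <;> interval_cases j <;> simp_all [f]
    · rcases a with _ | _ | _ | a <;> simp [nbrs_eq] at hb ⊢ <;> omega
    · rcases a with _ | _ | _ | a <;> simp [nbrs_eq] at hb
      · simpa [hb, f] using hxz
      · rcases hb with rfl | rfl
        · simpa [f] using hxz.symm
        · simpa [f] using hzy
      · simpa [hb, f] using hzy.symm
  obtain ⟨B, hB, g, hg⟩ := hf.exists_extension hG (x := 0) (y := 2) (used := []) (L := 5)
    (by simp) (by simp) (by simp) rfl rfl p hp hl (by simp)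
  exact not_realizes_of_refutes hG refutes_plan B hB g hg

end SixPaths

/-- There is no uniquely `C_7`-saturated graph with at least 7 vertices. -/
theorem stmt_13 {V : Type*} [Fintype V] (G : SimpleGraph V)
    (hn : 7 ≤ Fintype.card V) : ¬ UniquelyCSat G 7 := by
  intro h
  obtain ⟨x, z, y, hxz, hzy, hxy, hadj⟩ := h.hasUniqueSixPaths.exists_induced_path hn
  exact hadj (h.hasUniqueSixPaths.adj hxz hzy hxy)
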